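/- arXiv:2504.16641 — 4 statements merged into one kernel-verified Lean document; each statement's English description precedes it below -/
import Mathlib

section
/- Let u₀ ∈ ℝ with u₀/(2π) irrational, let l ∈ ℤ, and set λ_k = 4π²k² − 2πu₀k for k ∈ ℤ. Let S = {λ_k − λ_l : k ∈ ℤ} ∪ {λ_l − λ_k : k ∈ ℤ}. Then: (i) for all n,m ∈ ℤ∖{l}: λ_n ≠ λ_l; λ_n = λ_m implies n = m; and λ_n + λ_m ≠ 2λ_l (so the numbers λ_l − λ_k, 0, λ_k − λ_l for k ∈ ℤ∖{l} are pairwise distinct); (ii) inf{|x − y| : x,y ∈ S, x ≠ y} > 0; (iii) for every strictly increasing bijection ν : ℤ → S there exists C > 0 such that ν(k) − ν(k−1) ≥ C·|k| for all k ∈ ℤ. -/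
open Set

noncomputable section

/-- The `k`-th eigenvalue of the operator `H = −Δ + u₀ i∂_x` on `(0,1)` with periodic
boundary conditions: `λ_k = 4π²k² − 2πu₀k`. -/
def lamP (u0 : ℝ) (k : ℤ) : ℝ := 4 * Real.pi ^ 2 * (k : ℝ) ^ 2 - 2 * Real.pi * u0 * k

/-- The set `S = {λ_k − λ_l : k ∈ ℤ} ∪ {λ_l − λ_k : k ∈ ℤ}` of signed spectral gaps. -/
def gapSet (u0 : ℝ) (l : ℤ) : Set ℝ :=
  (range fun k : ℤ => lamP u0 k - lamP u0 l) ∪ (range fun k : ℤ => lamP u0 l - lamP u0 k)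

/-- The gap polynomial `s² - b s`, which is `λ_{l+s} - λ_l` up to the factor `4π²`. -/
def gapPoly (b : ℝ) (s : ℤ) : ℝ := (s : ℝ) ^ 2 - b * s

lemma lamP_sub_lamP (u0 : ℝ) (l k : ℤ) :
    lamP u0 k - lamP u0 l =
      4 * Real.pi ^ 2 * gapPoly (u0 / (2 * Real.pi) - 2 * l) (k - l) := by
  unfold lamP gapPoly
  push_cast
  field_simp
  ring

lemma mem_gapSet_iff {u0 : ℝ} {l : ℤ} {x : ℝ} :
    x ∈ gapSet u0 l ↔ ∃ s : ℤ,
      x = 4 * Real.pi ^ 2 * gapPoly (u0 / (2 * Real.pi) - 2 * l) s ∨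
      x = -(4 * Real.pi ^ 2 * gapPoly (u0 / (2 * Real.pi) - 2 * l) s) := by
  have neg_sub_lamP (k : ℤ) : lamP u0 l - lamP u0 k =
      -(4 * Real.pi ^ 2 * gapPoly (u0 / (2 * Real.pi) - 2 * l) (k - l)) := by
    rw [← lamP_sub_lamP]; ring
  constructor
  · rintro (⟨k, rfl⟩ | ⟨k, rfl⟩)
    · exact ⟨k - l, Or.inl (lamP_sub_lamP u0 l k)⟩
    · exact ⟨k - l, Or.inr (neg_sub_lamP k)⟩
  · rintro ⟨s, rfl | rfl⟩
    · refine Or.inl ⟨s + l, ?_⟩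
      simp only [lamP_sub_lamP, add_sub_cancel_right]
    · refine Or.inr ⟨s + l, ?_⟩
      simp only [neg_sub_lamP, add_sub_cancel_right]

lemma one_le_four_mul_pi_sq : (1 : ℝ) ≤ 4 * Real.pi ^ 2 := by
  nlinarith [Real.pi_gt_three]

lemma Irrational.gapPoly_injective {b : ℝ} (hb : Irrational b) :
    Function.Injective (gapPoly b) := by
  intro s t h
  by_contra hst
  have h1 : ((s : ℝ) - t) * (s + t - b) = 0 := by unfold gapPoly at h; linarith
  rcases mul_eq_zero.1 h1 with h2 | h2
  · exact hst (by exact_mod_cast sub_eq_zero.1 h2)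
  · exact hb.ne_int (s + t) (by push_cast; linarith)

lemma Irrational.gapPoly_add_eq_zero {b : ℝ} (hb : Irrational b) {s t : ℤ}
    (h : gapPoly b s + gapPoly b t = 0) : s = 0 ∧ t = 0 := by
  have h1 : (s : ℝ) ^ 2 + t ^ 2 = b * ((s + t : ℤ) : ℝ) := by
    unfold gapPoly at h; push_cast; linarith
  have hst : s + t = 0 := by
    by_contra hne
    refine (hb.mul_intCast hne).ne_int (s ^ 2 + t ^ 2) ?_
    push_cast at h1 ⊢
    exact h1.symm
  rw [hst] at h1
  have h2 : s ^ 2 + t ^ 2 = 0 := by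
    have : (s : ℝ) ^ 2 + t ^ 2 = 0 := by simpa using h1
    exact_mod_cast this
  constructor <;> nlinarith [sq_nonneg s, sq_nonneg t]

lemma Irrational.exists_le_abs_gapPoly_sub {b : ℝ} (hb : Irrational b) :
    ∃ c > (0 : ℝ), ∀ s t : ℤ, s ≠ t → c * (1 + |(s : ℝ)|) ≤ |gapPoly b s - gapPoly b t| := by
  set d : ℝ := |b - round b|
  have hd0 : 0 < d := abs_pos.2 (sub_ne_zero.2 (hb.ne_int _))
  have hd1 : d ≤ 1 := (abs_sub_round b).trans (by norm_num)
  refine ⟨d / (2 + |b| / 2), by positivity, fun s t hst => ?_⟩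
  have hfac : gapPoly b s - gapPoly b t = ((s : ℝ) - t) * (s + t - b) := by
    unfold gapPoly; ring
  have hA : 1 ≤ |(s : ℝ) - t| := by
    exact_mod_cast Int.one_le_abs (sub_ne_zero.2 hst)
  have hB : d ≤ |(s : ℝ) + t - b| := by
    have := round_le b (s + t)
    rw [abs_sub_comm b ((s + t : ℤ) : ℝ)] at this
    exact_mod_cast this
  have hsum : 2 * |(s : ℝ)| ≤ |(s : ℝ) - t| + |(s : ℝ) + t - b| + |b| := by
    have h := abs_add_three ((s : ℝ) - t) (s + t - b) b
    have h2 : (s : ℝ) - t + (s + t - b) + b = 2 * s := by ring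
    rwa [h2, abs_mul, abs_two] at h
  rw [hfac, abs_mul, div_mul_eq_mul_div, div_le_iff₀ (by positivity)]
  have h1 : d * |(s : ℝ) - t| ≤ |(s : ℝ) - t| * |(s : ℝ) + t - b| := by
    rw [mul_comm d]; gcongr
  have h2 : d * |(s : ℝ) + t - b| ≤ |(s : ℝ) - t| * |(s : ℝ) + t - b| := by
    gcongr; exact hd1.trans hA
  have h3 : d ≤ |(s : ℝ) - t| * |(s : ℝ) + t - b| := by nlinarith
  nlinarith [mul_le_mul_of_nonneg_left hsum hd0.le, mul_le_mul_of_nonneg_right h3 (abs_nonneg b)]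

lemma Finset.exists_pos_forall_le {α : Type*} (F : Finset α) (h : α → ℝ)
    (hF : ∀ p ∈ F, 0 < h p) : ∃ ε > (0 : ℝ), ∀ p ∈ F, ε ≤ h p := by
  rcases F.eq_empty_or_nonempty with rfl | hne
  · exact ⟨1, one_pos, by simp⟩
  · obtain ⟨p, hp, hmin⟩ := F.exists_min_image h hne
    exact ⟨h p, hF p hp, hmin⟩

lemma abs_le_add_abs_gapPoly_add (b : ℝ) (s t : ℤ) :
    |(s : ℝ)| ≤ |b| + 1 + b ^ 2 + |gapPoly b s + gapPoly b t| := by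
  have h1 : ((s : ℝ) - b / 2) ^ 2 ≤ b ^ 2 / 2 + |gapPoly b s + gapPoly b t| := by
    have := le_abs_self (gapPoly b s + gapPoly b t)
    unfold gapPoly at this ⊢
    nlinarith [sq_nonneg ((t : ℝ) - b / 2)]
  have h2 : |(s : ℝ)| ≤ |(s : ℝ) - b / 2| + |b| / 2 := by
    have := abs_add_le ((s : ℝ) - b / 2) (b / 2)
    rwa [sub_add_cancel, abs_div, abs_two] at this
  nlinarith [sq_abs ((s : ℝ) - b / 2), sq_nonneg (|(s : ℝ) - b / 2| - 1), abs_nonneg b,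
    sq_nonneg b, abs_nonneg ((s : ℝ) - b / 2)]

lemma Irrational.exists_le_abs_gapPoly_add {b : ℝ} (hb : Irrational b) :
    ∃ c > (0 : ℝ), ∀ s t : ℤ, ¬(s = 0 ∧ t = 0) →
      c * (1 + |(s : ℝ)|) ≤ |gapPoly b s + gapPoly b t| := by
  set K : ℝ := |b| + 1 + b ^ 2
  have hK0 : 0 < K := by positivity
  obtain ⟨N, hN⟩ := exists_nat_ge (K + 1)
  obtain ⟨ε, hε, hmin⟩ := Finset.exists_pos_forall_le
    ((Finset.Icc (-(N : ℤ)) N ×ˢ Finset.Icc (-(N : ℤ)) N).filter fun p => ¬(p.1 = 0 ∧ p.2 = 0))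
    (fun p => |gapPoly b p.1 + gapPoly b p.2|) (fun p hp =>
      abs_pos.2 fun h => (Finset.mem_filter.1 hp).2 (hb.gapPoly_add_eq_zero h))
  have mem_Icc (s : ℤ) (hs : |(s : ℝ)| ≤ K + 1) : s ∈ Finset.Icc (-(N : ℤ)) N := by
    have : |s| ≤ (N : ℤ) := by exact_mod_cast hs.trans hN
    exact Finset.mem_Icc.2 (abs_le.1 this)
  set η := min ε 1
  have hη0 : 0 < η := lt_min hε one_pos
  have hlow (s t : ℤ) (hst : ¬(s = 0 ∧ t = 0)) : η ≤ |gapPoly b s + gapPoly b t| := by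
    by_cases hg : |gapPoly b s + gapPoly b t| ≤ 1
    · have hs := abs_le_add_abs_gapPoly_add b s t
      have ht := abs_le_add_abs_gapPoly_add b t s
      rw [add_comm (gapPoly b t)] at ht
      exact (min_le_left _ _).trans (hmin (s, t) (Finset.mem_filter.2
        ⟨Finset.mem_product.2 ⟨mem_Icc s (by linarith), mem_Icc t (by linarith)⟩, hst⟩))
    · exact (min_le_right _ _).trans (not_le.1 hg).le
  refine ⟨η / (1 + K + η), by positivity, fun s t hst => ?_⟩
  have h1 := hlow s t hst
  have h2 := abs_le_add_abs_gapPoly_add b s t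
  rw [div_mul_eq_mul_div, div_le_iff₀ (by positivity)]
  nlinarith

lemma sqrt_four_mul_pi_sq_mul_le (b : ℝ) (s : ℤ) :
    √(4 * Real.pi ^ 2 * |gapPoly b s|) ≤ 4 * Real.pi ^ 2 * (|(s : ℝ)| + |b|) := by
  have hP := one_le_four_mul_pi_sq
  set P := 4 * Real.pi ^ 2
  have h1 : |gapPoly b s| ≤ (|(s : ℝ)| + |b|) ^ 2 := by
    unfold gapPoly
    have h := abs_sub ((s : ℝ) ^ 2) (b * s)
    rw [abs_mul, abs_of_nonneg (sq_nonneg (s : ℝ)), ← sq_abs (s : ℝ)] at h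
    rw [← sq_abs (s : ℝ)]
    nlinarith [mul_nonneg (abs_nonneg b) (abs_nonneg (s : ℝ)), sq_nonneg |b|]
  refine Real.sqrt_le_iff.2 ⟨by positivity, ?_⟩
  rw [mul_pow]
  gcongr
  nlinarith

/-- Distinct signed gaps `x`, `y` are at distance at least a multiple of `1 + √|x|`. -/
lemma exists_le_abs_sub_of_mem_gapSet {u0 : ℝ} (hu0 : Irrational (u0 / (2 * Real.pi))) (l : ℤ) :
    ∃ c > (0 : ℝ), ∀ x ∈ gapSet u0 l, ∀ y ∈ gapSet u0 l, x ≠ y →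
      c * (1 + √|x|) ≤ |x - y| := by
  have hb : Irrational (u0 / (2 * Real.pi) - 2 * l) := by
    exact_mod_cast hu0.sub_intCast (2 * l)
  obtain ⟨c₁, hc₁, h₁⟩ := hb.exists_le_abs_gapPoly_sub
  obtain ⟨c₂, hc₂, h₂⟩ := hb.exists_le_abs_gapPoly_add
  simp only [mem_gapSet_iff]
  set b := u0 / (2 * Real.pi) - 2 * l
  set c := min c₁ c₂
  have hc0 : 0 < c := lt_min hc₁ hc₂
  have hsqrt := sqrt_four_mul_pi_sq_mul_le b
  have hP := one_le_four_mul_pi_sq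
  set P := 4 * Real.pi ^ 2
  clear_value P
  have hP0 : 0 < P := one_pos.trans_le hP
  have habs (g : ℝ) : |P * g| = P * |g| := by rw [abs_mul, abs_of_pos hP0]
  have key (s : ℤ) (g : ℝ) (hg : c * (1 + |(s : ℝ)|) ≤ |g|) :
      c / (1 + |b|) * (1 + √(P * |gapPoly b s|)) ≤ P * |g| := by
    rw [div_mul_eq_mul_div, div_le_iff₀ (by positivity)]
    have h3 : 1 + √(P * |gapPoly b s|) ≤ P * ((1 + |(s : ℝ)|) * (1 + |b|)) := by
      have := hsqrt s
      nlinarith [mul_nonneg hP0.le (mul_nonneg (abs_nonneg b) (abs_nonneg (s : ℝ)))]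
    calc c * (1 + √(P * |gapPoly b s|)) ≤ c * (P * ((1 + |(s : ℝ)|) * (1 + |b|))) := by gcongr
      _ = P * (c * (1 + |(s : ℝ)|)) * (1 + |b|) := by ring
      _ ≤ P * |g| * (1 + |b|) := by gcongr
  have keySub (s t : ℤ) (h : gapPoly b s ≠ gapPoly b t) :
      c / (1 + |b|) * (1 + √(P * |gapPoly b s|)) ≤ P * |gapPoly b s - gapPoly b t| :=
    key s _ (le_trans (by gcongr; exact min_le_left _ _) (h₁ s t (fun e => h (by rw [e]))))
  have keyAdd (s t : ℤ) (h : gapPoly b s + gapPoly b t ≠ 0) :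
      c / (1 + |b|) * (1 + √(P * |gapPoly b s|)) ≤ P * |gapPoly b s + gapPoly b t| := by
    refine key s _ (le_trans (by gcongr; exact min_le_right _ _) (h₂ s t ?_))
    rintro ⟨rfl, rfl⟩
    simp [gapPoly] at h
  refine ⟨c / (1 + |b|), by positivity, ?_⟩
  rintro x ⟨s, rfl | rfl⟩ y ⟨t, rfl | rfl⟩ hxy
  · rw [← mul_sub, habs, habs]
    exact keySub s t fun e => hxy (by rw [e])
  · rw [sub_neg_eq_add, ← mul_add, habs, habs]
    exact keyAdd s t fun e => hxy (by linear_combination P * e)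
  · rw [← neg_add', ← mul_add, abs_neg, abs_neg, habs, habs]
    exact keyAdd s t fun e => hxy (by linear_combination -P * e)
  · rw [← neg_sub', ← mul_sub, abs_neg, abs_neg, habs, habs]
    exact keySub s t fun e => hxy (by rw [e])

lemma abs_le_add_sqrt_of_abs_gapPoly_le {b M : ℝ} {s : ℤ} (h : |gapPoly b s| ≤ M) :
    |(s : ℝ)| ≤ |b| + √M := by
  have hM : 0 ≤ M := (abs_nonneg _).trans h
  have h1 : |(s : ℝ)| ^ 2 ≤ M + |b| * |(s : ℝ)| := by
    have h2 := (le_abs_self _).trans h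
    have h3 := le_abs_self (b * (s : ℝ))
    rw [abs_mul] at h3
    rw [sq_abs]
    unfold gapPoly at h2
    linarith
  by_contra! hlt
  nlinarith [Real.sq_sqrt hM, Real.sqrt_nonneg M, abs_nonneg b]

/-- The signed gaps of absolute value at most `M` lie in a finite set of size `O(1 + √M)`. -/
lemma exists_finset_gapSet (u0 : ℝ) (l : ℤ) (M : ℝ) :
    ∃ U : Finset ℝ, (U.card : ℝ) ≤ 4 * (|u0 / (2 * Real.pi) - 2 * l| + √M) + 2 ∧
      ∀ x ∈ gapSet u0 l, |x| ≤ M → x ∈ U := by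
  set b := u0 / (2 * Real.pi) - 2 * l
  have hP := one_le_four_mul_pi_sq
  set T := ⌊|b| + √M⌋₊
  have hTle : (T : ℝ) ≤ |b| + √M := Nat.floor_le (by positivity)
  refine ⟨(Finset.Icc (-(T : ℤ)) T).image (fun s => 4 * Real.pi ^ 2 * gapPoly b s) ∪
    (Finset.Icc (-(T : ℤ)) T).image (fun s => -(4 * Real.pi ^ 2 * gapPoly b s)), ?_, ?_⟩
  · have hI : (Finset.Icc (-(T : ℤ)) T).card = 2 * T + 1 := by
      rw [Int.card_Icc]; omega
    refine le_trans (Nat.cast_le.2 ((Finset.card_union_le _ _).trans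
      (add_le_add Finset.card_image_le Finset.card_image_le))) ?_
    rw [hI]
    push_cast
    linarith
  · intro x hx hxM
    have mem_Icc (s : ℤ) (hs : 4 * Real.pi ^ 2 * |gapPoly b s| ≤ M) :
        s ∈ Finset.Icc (-(T : ℤ)) T := by
      have h1 : |gapPoly b s| ≤ M := by nlinarith [abs_nonneg (gapPoly b s)]
      have h2 := abs_le_add_sqrt_of_abs_gapPoly_le h1
      rw [← Int.cast_abs, ← Nat.cast_natAbs] at h2
      have h3 : s.natAbs ≤ T := Nat.le_floor h2
      rw [Finset.mem_Icc]
      omega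
    rw [Finset.mem_union, Finset.mem_image, Finset.mem_image]
    obtain ⟨s, rfl | rfl⟩ := mem_gapSet_iff.1 hx
    · rw [abs_mul, abs_of_pos (by positivity)] at hxM
      exact Or.inl ⟨s, mem_Icc s hxM, rfl⟩
    · rw [abs_neg, abs_mul, abs_of_pos (by positivity)] at hxM
      exact Or.inr ⟨s, mem_Icc s hxM, rfl⟩

/-- A strictly increasing enumeration of the signed gaps grows at least quadratically. -/
lemma exists_abs_le_mul_one_add_sqrt {u0 : ℝ} {l : ℤ} {ν : ℤ → ℝ} (hν : StrictMono ν)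
    (hrange : range ν = gapSet u0 l) :
    ∃ K > (0 : ℝ), ∀ k : ℤ, |(k : ℝ)| ≤ K * (1 + √|ν k|) := by
  set b := u0 / (2 * Real.pi) - 2 * l
  refine ⟨4 * |b| + 4 * √|ν 0| + 4, by positivity, fun k => ?_⟩
  obtain ⟨U, hcard, hU⟩ := exists_finset_gapSet u0 l (|ν 0| + |ν k|)
  have hmaps : ∀ j ∈ Finset.uIcc 0 k, ν j ∈ U := by
    intro j hj
    refine hU _ (hrange ▸ mem_range_self j) ?_
    have h0 := abs_nonneg (ν 0)
    have hk := abs_nonneg (ν k)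
    have h0' := abs_le.1 (le_refl |ν 0|)
    have hk' := abs_le.1 (le_refl |ν k|)
    rcases Finset.mem_uIcc.1 hj |> Set.mem_uIcc.1 with ⟨h1, h2⟩ | ⟨h1, h2⟩ <;>
    · have h3 := hν.monotone h1
      have h4 := hν.monotone h2
      exact abs_le.2 ⟨by linarith, by linarith⟩
  have hle := Finset.card_le_card_of_injOn ν hmaps hν.injective.injOn
  rw [Int.card_uIcc, sub_zero] at hle
  have hle' : |(k : ℝ)| + 1 ≤ U.card := by
    rw [← Int.cast_abs, ← Nat.cast_natAbs]
    exact_mod_cast hle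
  have hsq : √(|ν 0| + |ν k|) ≤ √|ν 0| + √|ν k| :=
    Real.sqrt_le_iff.2 ⟨by positivity, by
      nlinarith [Real.sq_sqrt (abs_nonneg (ν 0)), Real.sq_sqrt (abs_nonneg (ν k)),
        mul_nonneg (Real.sqrt_nonneg |ν 0|) (Real.sqrt_nonneg |ν k|)]⟩
  nlinarith [abs_nonneg b, Real.sqrt_nonneg |ν 0|, Real.sqrt_nonneg |ν k|,
    mul_nonneg (abs_nonneg b) (Real.sqrt_nonneg |ν k|),
    mul_nonneg (Real.sqrt_nonneg |ν 0|) (Real.sqrt_nonneg |ν k|)]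

/-- Zeeman-type decoupling of the resonant spectrum: for `u₀ ∉ 2πℚ` and
`l ∈ ℤ`, (i) the eigenvalues `λ_k = 4π²k² − 2πu₀k` are simple and `λ_n + λ_m ≠ 2λ_l` for
`n,m ≠ l`; (ii) the set `S` of signed gaps is uniformly separated; (iii) any strictly
increasing enumeration `ν : ℤ → S` has gaps `ν(k) − ν(k−1) ≥ C|k|`. -/
theorem statement7
    (u0 : ℝ) (hu0 : Irrational (u0 / (2 * Real.pi))) (l : ℤ) :
    (∀ n m : ℤ, n ≠ l → m ≠ l →
      lamP u0 n ≠ lamP u0 l ∧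
      (lamP u0 n = lamP u0 m → n = m) ∧
      lamP u0 n + lamP u0 m ≠ 2 * lamP u0 l) ∧
    (∃ ε > (0:ℝ), ∀ x ∈ gapSet u0 l, ∀ y ∈ gapSet u0 l, x ≠ y → ε ≤ |x - y|) ∧
    (∀ ν : ℤ → ℝ, StrictMono ν → range ν = gapSet u0 l →
      ∃ C > (0:ℝ), ∀ k : ℤ, C * |(k : ℝ)| ≤ ν k - ν (k - 1)) := by
  have hb : Irrational (u0 / (2 * Real.pi) - 2 * l) := by
    exact_mod_cast hu0.sub_intCast (2 * l)
  have hP : (4 * Real.pi ^ 2 : ℝ) ≠ 0 := (one_pos.trans_le one_le_four_mul_pi_sq).ne'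
  have hinj : Function.Injective (lamP u0) := by
    intro n m h
    have h1 : lamP u0 n - lamP u0 l = lamP u0 m - lamP u0 l := by rw [h]
    rw [lamP_sub_lamP, lamP_sub_lamP] at h1
    exact sub_left_injective (hb.gapPoly_injective (mul_left_cancel₀ hP h1))
  obtain ⟨c, hc, hsep⟩ := exists_le_abs_sub_of_mem_gapSet hu0 l
  refine ⟨fun n m hn _ => ⟨hinj.ne hn, fun h => hinj h, fun h => ?_⟩,
    ⟨c, hc, fun x hx y hy hxy => ?_⟩, fun ν hν hrange => ?_⟩
  · have h1 : (lamP u0 n - lamP u0 l) + (lamP u0 m - lamP u0 l) = 0 := by linarith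
    rw [lamP_sub_lamP, lamP_sub_lamP, ← mul_add] at h1
    exact hn (sub_eq_zero.1 (hb.gapPoly_add_eq_zero ((mul_eq_zero.1 h1).resolve_left hP)).1)
  · exact (le_mul_of_one_le_right hc.le (by simp)).trans (hsep x hx y hy hxy)
  · obtain ⟨K, hK, hgrow⟩ := exists_abs_le_mul_one_add_sqrt hν hrange
    refine ⟨c / K, by positivity, fun k => ?_⟩
    have hlt : ν (k - 1) < ν k := hν (by omega)
    have hgap := hsep (ν k) (hrange ▸ mem_range_self k) (ν (k - 1))
      (hrange ▸ mem_range_self (k - 1)) hlt.ne'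
    rw [abs_of_pos (sub_pos.2 hlt)] at hgap
    calc c / K * |(k : ℝ)| ≤ c / K * (K * (1 + √|ν k|)) := by gcongr; exact hgrow k
      _ = c * (1 + √|ν k|) := by field_simp
      _ ≤ ν k - ν (k - 1) := hgap

end
end

section
/- For every a ∈ ℝ and every k ∈ ℕ*, ∫_a^{+∞} φ_k(x)·φ₀(x) dx = e^{−a²/2}·φ_{k−1}(a)/(π^{1/4}·√(2k)). In particular the L² inner product of the truncated ground state 1_{[a,+∞)}·φ₀ with φ_k equals, up to the explicit constant (π^{1/4}√(2k))^{−1}e^{−a²/2}, the value of the (k−1)-st Hermite function at the truncation point a. -/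
open MeasureTheory Set

noncomputable section

/-- The `k`-th Hermite function
`φ_k(x) = (−1)^k (√π 2^k k!)^{-1/2} e^{x²/2} (d/dx)^k e^{−x²}`. -/
def hermiteFun (k : ℕ) (x : ℝ) : ℝ :=
  (-1) ^ k * (Real.sqrt (Real.sqrt Real.pi * 2 ^ k * Nat.factorial k))⁻¹ *
    Real.exp (x ^ 2 / 2) * deriv^[k] (fun y => Real.exp (-y ^ 2)) x

/-- Every iterated derivative of `e^{-x²}` is a polynomial multiple of `e^{-x²}`. -/
theorem exists_polynomial_iterate_deriv_exp_neg_sq (k : ℕ) :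
    ∃ p : Polynomial ℝ, deriv^[k] (fun y : ℝ => Real.exp (-y ^ 2)) =
      fun x => p.eval x * Real.exp (-x ^ 2) := by
  induction k with
  | zero => exact ⟨1, by simp⟩
  | succ k ih =>
    obtain ⟨p, hp⟩ := ih
    refine ⟨Polynomial.derivative p - 2 * Polynomial.X * p, ?_⟩
    rw [Function.iterate_succ_apply', hp]
    funext x
    have h : HasDerivAt (fun y : ℝ => Real.exp (-y ^ 2)) (Real.exp (-x ^ 2) * -(2 * x)) x := by
      simpa using ((hasDerivAt_pow 2 x).neg).exp
    refine ((p.hasDerivAt x).mul h).deriv.trans ?_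
    simp
    ring

theorem hasDerivAt_iterate_deriv_exp_neg_sq (k : ℕ) (x : ℝ) :
    HasDerivAt (deriv^[k] (fun y : ℝ => Real.exp (-y ^ 2)))
      (deriv^[k + 1] (fun y : ℝ => Real.exp (-y ^ 2)) x) x := by
  rw [Function.iterate_succ_apply']
  apply DifferentiableAt.hasDerivAt
  obtain ⟨p, hp⟩ := exists_polynomial_iterate_deriv_exp_neg_sq k
  rw [hp]
  fun_prop

theorem integrable_polynomial_mul_exp_neg_sq (p : Polynomial ℝ) :
    Integrable (fun x : ℝ => p.eval x * Real.exp (-x ^ 2)) := by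
  induction p using Polynomial.induction_on' with
  | add p q hp hq =>
    simp only [Polynomial.eval_add, add_mul]
    exact hp.add hq
  | monomial n c =>
    have h := integrable_rpow_mul_exp_neg_mul_sq one_pos
      (show (-1 : ℝ) < n from neg_one_lt_zero.trans_le n.cast_nonneg)
    simpa [Real.rpow_natCast, mul_assoc] using h.const_mul c

theorem integrable_iterate_deriv_exp_neg_sq (k : ℕ) :
    Integrable (deriv^[k] (fun y : ℝ => Real.exp (-y ^ 2))) := by
  obtain ⟨p, hp⟩ := exists_polynomial_iterate_deriv_exp_neg_sq k
  exact hp ▸ integrable_polynomial_mul_exp_neg_sq p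

theorem integral_Ioi_iterate_deriv_exp_neg_sq (k : ℕ) (a : ℝ) :
    ∫ x in Ioi a, deriv^[k + 1] (fun y : ℝ => Real.exp (-y ^ 2)) x =
      -deriv^[k] (fun y : ℝ => Real.exp (-y ^ 2)) a := by
  have hd := hasDerivAt_iterate_deriv_exp_neg_sq k
  have hi := (integrable_iterate_deriv_exp_neg_sq k).integrableOn (s := Ioi a)
  have hi' := (integrable_iterate_deriv_exp_neg_sq (k + 1)).integrableOn (s := Ioi a)
  rw [integral_Ioi_of_hasDerivAt_of_tendsto' (fun x _ => hd x) hi'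
    (tendsto_zero_of_hasDerivAt_of_integrableOn_Ioi (fun x _ => hd x) hi' hi), zero_sub]

/-- Exact formula for the Hermite coefficients of the truncated ground
state: for every `a ∈ ℝ` and `k ∈ ℕ*`,
`∫_a^∞ φ_k(x) φ₀(x) dx = e^{−a²/2} φ_{k−1}(a) / (π^{1/4} √(2k))`. -/
theorem statement15 (a : ℝ) (k : ℕ) (hk : 1 ≤ k) :
    ∫ x in Ioi a, hermiteFun k x * hermiteFun 0 x =
      Real.exp (-a ^ 2 / 2) * hermiteFun (k - 1) a /
        (Real.pi ^ ((1:ℝ)/4) * Real.sqrt (2 * k)) := by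
  obtain ⟨k, rfl⟩ := Nat.exists_eq_add_of_le' hk
  have hπ : Real.pi ^ ((1 : ℝ) / 4) = Real.sqrt (Real.sqrt Real.pi) := by
    rw [Real.sqrt_eq_rpow, Real.sqrt_eq_rpow, ← Real.rpow_mul Real.pi_pos.le]
    norm_num
  have hc : Real.sqrt (Real.sqrt Real.pi * 2 ^ (k + 1) * (k + 1).factorial) =
      Real.sqrt (Real.sqrt Real.pi * 2 ^ k * k.factorial) * Real.sqrt (2 * (k + 1 : ℕ)) := by
    rw [← Real.sqrt_mul (by positivity), Nat.factorial_succ]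
    congr 1
    push_cast
    ring
  have hexp (x : ℝ) : Real.exp (x ^ 2 / 2) * Real.exp (x ^ 2 / 2) * Real.exp (-x ^ 2) = 1 := by
    rw [← Real.exp_add, ← Real.exp_add, ← Real.exp_zero]
    ring_nf
  have hexp' : Real.exp (-a ^ 2 / 2) * Real.exp (a ^ 2 / 2) = 1 := by
    rw [← Real.exp_add, ← Real.exp_zero]
    ring_nf
  have hprod (x : ℝ) : hermiteFun (k + 1) x * hermiteFun 0 x =
      (-1) ^ (k + 1) * (Real.sqrt (Real.sqrt Real.pi * 2 ^ (k + 1) * (k + 1).factorial))⁻¹ *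
        (Real.sqrt (Real.sqrt Real.pi))⁻¹ *
        deriv^[k + 1] (fun y : ℝ => Real.exp (-y ^ 2)) x := by
    simp only [hermiteFun, Function.iterate_zero, id, pow_zero, Nat.factorial_zero, Nat.cast_one,
      mul_one, one_mul]
    linear_combination ((-1) ^ (k + 1) *
      (Real.sqrt (Real.sqrt Real.pi * 2 ^ (k + 1) * (k + 1).factorial))⁻¹ *
        (Real.sqrt (Real.sqrt Real.pi))⁻¹ *
        deriv^[k + 1] (fun y : ℝ => Real.exp (-y ^ 2)) x) * hexp x
  simp_rw [hprod]
  rw [integral_const_mul, integral_Ioi_iterate_deriv_exp_neg_sq, hc, hπ, Nat.add_sub_cancel,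
    hermiteFun, mul_inv, div_eq_mul_inv _ (_ * _), mul_inv]
  linear_combination (-((-1) ^ k * (Real.sqrt (Real.sqrt Real.pi * 2 ^ k * k.factorial))⁻¹ *
    (Real.sqrt (2 * (k + 1 : ℕ)))⁻¹ * (Real.sqrt (Real.sqrt Real.pi))⁻¹ *
    deriv^[k] (fun y : ℝ => Real.exp (-y ^ 2)) a)) * hexp'

end
end

section
/- For every compact set K ⊂ ℝ there exists a constant C > 0 such that |φ_k(x)| ≤ C·k^{−1/4} for every k ∈ ℕ* and every x ∈ K. -/
open Set

noncomputable section

/-- The physicists' Hermite polynomials as functions on `ℝ`, given by their three-term recurrence. -/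
def physHermite : ℕ → ℝ → ℝ
  | 0, _ => 1
  | 1, x => 2 * x
  | n + 2, x => 2 * x * physHermite (n + 1) x - 2 * (n + 1) * physHermite n x

theorem physHermite_succ (n : ℕ) (x : ℝ) :
    physHermite (n + 1) x = 2 * x * physHermite n x - 2 * n * physHermite (n - 1) x := by
  cases n <;> simp [physHermite]

theorem hasDerivAt_physHermite (n : ℕ) (x : ℝ) :
    HasDerivAt (physHermite n) (2 * n * physHermite (n - 1) x) x := by
  induction n using Nat.twoStepInduction with
  | zero => simpa [physHermite] using hasDerivAt_const x (1 : ℝ)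
  | one => simpa [physHermite] using (hasDerivAt_id x).const_mul (2 : ℝ)
  | more n h₀ h₁ =>
    have h := (((hasDerivAt_id x).const_mul (2 : ℝ)).mul h₁).sub
      (h₀.const_mul (2 * ((n : ℝ) + 1)))
    refine h.congr_deriv ?_
    have hs := physHermite_succ n x
    simp only [id, Nat.add_succ_sub_one, add_tsub_cancel_right]
    rw [hs]
    push_cast
    ring

theorem iterate_deriv_exp_neg_sq (n : ℕ) :
    deriv^[n] (fun y : ℝ => Real.exp (-y ^ 2)) =
      fun y => (-1) ^ n * physHermite n y * Real.exp (-y ^ 2) := by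
  induction n with
  | zero => simp [physHermite]
  | succ n ih =>
    rw [Function.iterate_succ_apply', ih]
    funext y
    have hexp : HasDerivAt (fun y : ℝ => Real.exp (-y ^ 2)) (Real.exp (-y ^ 2) * -(2 * y)) y := by
      simpa using ((hasDerivAt_pow 2 y).neg).exp
    have h := ((hasDerivAt_physHermite n y).const_mul ((-1 : ℝ) ^ n)).mul hexp
    refine h.deriv.trans ?_
    rw [physHermite_succ, pow_succ]
    ring

theorem hermiteFun_eq (k : ℕ) (x : ℝ) :
    hermiteFun k x = (Real.sqrt (Real.sqrt Real.pi * 2 ^ k * Nat.factorial k))⁻¹ *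
      (physHermite k x * Real.exp (-x ^ 2 / 2)) := by
  have he : Real.exp (x ^ 2 / 2) * Real.exp (-x ^ 2) = Real.exp (-x ^ 2 / 2) := by
    rw [← Real.exp_add]
    ring_nf
  have hs : ((-1 : ℝ) ^ k) * (-1) ^ k = 1 := by
    rw [← mul_pow]
    simp
  rw [hermiteFun, iterate_deriv_exp_neg_sq, ← he]
  linear_combination (Real.sqrt (Real.sqrt Real.pi * 2 ^ k * Nat.factorial k))⁻¹ *
    physHermite k x * Real.exp (x ^ 2 / 2) * Real.exp (-x ^ 2) * hs

theorem continuous_hermiteFun (k : ℕ) : Continuous (hermiteFun k) := by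
  have h : Continuous (physHermite k) :=
    continuous_iff_continuousAt.2 fun x => (hasDerivAt_physHermite k x).continuousAt
  rw [funext (hermiteFun_eq k)]
  fun_prop

/-- The energy `u'² + (2k + 1 - x²) u²` of the solution `u = H_k e^{-x²/2}` of
`u'' + (2k + 1 - x²) u = 0`. -/
def hermiteEnergy (k : ℕ) (x : ℝ) : ℝ :=
  Real.exp (-x ^ 2) * ((2 * k * physHermite (k - 1) x - x * physHermite k x) ^ 2 +
    (2 * k + 1 - x ^ 2) * physHermite k x ^ 2)

theorem hasDerivAt_hermiteEnergy (k : ℕ) (x : ℝ) :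
    HasDerivAt (hermiteEnergy k) (-2 * x * (Real.exp (-x ^ 2) * physHermite k x ^ 2)) x := by
  have hexp : HasDerivAt (fun y : ℝ => Real.exp (-y ^ 2)) (Real.exp (-x ^ 2) * -(2 * x)) x := by
    simpa using ((hasDerivAt_pow 2 x).neg).exp
  have hk := hasDerivAt_physHermite k x
  have hk' := hasDerivAt_physHermite (k - 1) x
  have h := hexp.mul ((((hk'.const_mul (2 * (k : ℝ))).sub ((hasDerivAt_id x).mul hk)).pow 2).add
    ((((hasDerivAt_pow 2 x).const_sub (2 * (k : ℝ) + 1))).mul (hk.pow 2)))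
  refine h.congr_deriv ?_
  rcases k with _ | k
  · simp [physHermite]
    ring
  · have hs := physHermite_succ k x
    simp only [id, Pi.mul_apply, Pi.add_apply, Pi.sub_apply, Pi.pow_apply,
      Nat.add_sub_cancel]
    rw [hs]
    push_cast
    ring

theorem hermiteEnergy_le_zero (k : ℕ) (x : ℝ) : hermiteEnergy k x ≤ hermiteEnergy k 0 := by
  have hd : Differentiable ℝ (hermiteEnergy k) :=
    fun y => (hasDerivAt_hermiteEnergy k y).differentiableAt
  have hw (y : ℝ) : 0 ≤ Real.exp (-y ^ 2) * physHermite k y ^ 2 := by positivity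
  rcases le_total 0 x with hx | hx
  · refine antitoneOn_of_deriv_nonpos (convex_Ici (0 : ℝ)) hd.continuous.continuousOn
      hd.differentiableOn (fun y hy => ?_) (mem_Ici.2 le_rfl) (mem_Ici.2 hx) hx
    rw [interior_Ici, mem_Ioi] at hy
    rw [(hasDerivAt_hermiteEnergy k y).deriv]
    nlinarith [mul_nonneg hy.le (hw y)]
  · refine monotoneOn_of_deriv_nonneg (convex_Iic (0 : ℝ)) hd.continuous.continuousOn
      hd.differentiableOn (fun y hy => ?_) (mem_Iic.2 hx) (mem_Iic.2 le_rfl) hx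
    rw [interior_Iic, mem_Iio] at hy
    rw [(hasDerivAt_hermiteEnergy k y).deriv]
    nlinarith [mul_nonneg (neg_nonneg.2 hy.le) (hw y)]

theorem physHermite_zero_pow_four_le (n : ℕ) :
    physHermite n 0 ^ 4 * (n + 1) ≤ (2 ^ n * Nat.factorial n : ℝ) ^ 2 := by
  induction n using Nat.twoStepInduction with
  | zero => simp [physHermite]
  | one => simp [physHermite]
  | more n h₀ _ =>
    have hr : physHermite (n + 2) 0 = -(2 * (n + 1)) * physHermite n 0 := by
      simp [physHermite]
    rw [hr, Nat.factorial_succ, Nat.factorial_succ]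
    push_cast
    calc (-(2 * ((n : ℝ) + 1)) * physHermite n 0) ^ 4 * (n + 2 + 1)
        = 16 * (n + 1) ^ 2 * ((n + 1) * (n + 3)) * (physHermite n 0 ^ 4 * (n + 1)) := by ring
      _ ≤ 16 * (n + 1) ^ 2 * (n + 2) ^ 2 * (2 ^ n * Nat.factorial n : ℝ) ^ 2 := by
        gcongr
        nlinarith
      _ = _ := by ring

theorem physHermite_zero_sq_le (n : ℕ) :
    physHermite n 0 ^ 2 * Real.sqrt (n + 1) ≤ 2 ^ n * Nat.factorial n := by
  refine abs_le_of_sq_le_sq' ?_ (by positivity) |>.2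
  rw [mul_pow, Real.sq_sqrt (by positivity), ← pow_mul]
  exact physHermite_zero_pow_four_le n

theorem hermiteEnergy_zero_le (k : ℕ) (hk : 1 ≤ k) :
    hermiteEnergy k 0 ≤ 5 * Real.sqrt k * (2 ^ k * Nat.factorial k) := by
  obtain ⟨n, rfl⟩ := Nat.exists_eq_add_of_le' hk
  have h₀ := physHermite_zero_sq_le n
  have h₁ := physHermite_zero_sq_le (n + 1)
  set s := Real.sqrt ((n + 1 : ℕ) : ℝ) with hs
  have hss : s ^ 2 = n + 1 := by
    rw [hs, Real.sq_sqrt (by positivity)]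
    push_cast
    rfl
  have hs0 : 0 < s := Real.sqrt_pos.2 (by positivity)
  have hsn : Real.sqrt ((n : ℝ) + 1) = s := by rw [hs]; push_cast; rfl
  rw [hsn] at h₀
  have h₂ : physHermite (n + 1) 0 ^ 2 * s ≤ 2 ^ (n + 1) * Nat.factorial (n + 1) := by
    refine le_trans ?_ h₁
    gcongr
    exact Real.sqrt_le_sqrt (by linarith)
  rw [Nat.factorial_succ] at h₂ ⊢
  push_cast at h₂ ⊢
  simp only [hermiteEnergy, Nat.add_sub_cancel]
  push_cast
  rw [← hss] at h₂ ⊢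
  refine le_of_mul_le_mul_right ?_ hs0
  have hs1 : 1 ≤ s ^ 2 := by rw [hss]; linarith [n.cast_nonneg (α := ℝ)]
  have e₀ := mul_le_mul_of_nonneg_left h₀ (show 0 ≤ 4 * s ^ 4 by positivity)
  have e₁ := mul_le_mul_of_nonneg_left h₂ (show 0 ≤ 2 * s ^ 2 + 1 by positivity)
  have e₂ : (1 : ℝ) * (2 ^ (n + 1) * (s ^ 2 * Nat.factorial n)) ≤
      s ^ 2 * (2 ^ (n + 1) * (s ^ 2 * Nat.factorial n)) := by gcongr
  simp only [neg_zero, ne_eq, OfNat.ofNat_ne_zero, not_false_eq_true, zero_pow, Real.exp_zero]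
  rw [pow_succ (2 : ℝ) n] at e₁ e₂ ⊢
  linarith

theorem abs_hermiteFun_le (k : ℕ) (hk : 1 ≤ k) (x : ℝ) (hx : x ^ 2 ≤ k + 1) :
    |hermiteFun k x| ≤ 3 * (k : ℝ) ^ (-(1 : ℝ) / 4) := by
  have hk0 : (0 : ℝ) < k := by exact_mod_cast hk
  have hs0 : 0 < Real.sqrt k := Real.sqrt_pos.2 hk0
  have hpow : ((k : ℝ) ^ (-(1 : ℝ) / 4)) ^ 2 = (Real.sqrt k)⁻¹ := by
    rw [← Real.rpow_natCast, ← Real.rpow_mul hk0.le, Real.sqrt_eq_rpow, ← Real.rpow_neg hk0.le]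
    norm_num
  have hE := (hermiteEnergy_le_zero k x).trans (hermiteEnergy_zero_le k hk)
  have hexp : Real.exp (-x ^ 2 / 2) ^ 2 = Real.exp (-x ^ 2) := by
    rw [← Real.exp_nat_mul]
    ring_nf
  have hu : k * (physHermite k x * Real.exp (-x ^ 2 / 2)) ^ 2 ≤ hermiteEnergy k x := by
    rw [mul_pow, hexp, hermiteEnergy]
    have hw : 0 ≤ Real.exp (-x ^ 2) * physHermite k x ^ 2 := by positivity
    have hv : 0 ≤ Real.exp (-x ^ 2) *
        (2 * k * physHermite (k - 1) x - x * physHermite k x) ^ 2 := by positivity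
    nlinarith [mul_nonneg (sub_nonneg.2 hx) hw]
  have hpi : 1 ≤ Real.sqrt Real.pi := Real.one_le_sqrt.2 (by linarith [Real.pi_gt_three])
  have hw0 : (0 : ℝ) < 2 ^ k * Nat.factorial k := by positivity
  refine abs_le_of_sq_le_sq ?_ (by positivity)
  rw [mul_pow, hpow, hermiteFun_eq, mul_pow, inv_pow, Real.sq_sqrt (by positivity),
    inv_mul_le_iff₀ (by positivity), ← mul_assoc, ← div_eq_mul_inv, le_div_iff₀ hs0]
  have hkk : (k : ℝ) = Real.sqrt k * Real.sqrt k := (Real.mul_self_sqrt hk0.le).symm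
  have hu' := hu.trans hE
  set u := (physHermite k x * Real.exp (-x ^ 2 / 2)) ^ 2
  have h5 : u * Real.sqrt k ≤ 5 * (2 ^ k * Nat.factorial k) := by
    refine le_of_mul_le_mul_right ?_ hs0
    calc u * Real.sqrt k * Real.sqrt k = k * u := by
          rw [mul_assoc, Real.mul_self_sqrt hk0.le, mul_comm]
      _ ≤ _ := hu'
      _ = _ := by ring
  nlinarith [mul_le_mul_of_nonneg_right hpi hw0.le]

/-- Uniform decay of the Hermite functions on compact sets:
for every compact `K ⊂ ℝ` there exists `C > 0` such that
`|φ_k(x)| ≤ C k^{−1/4}` for every `k ∈ ℕ*` and every `x ∈ K`. -/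
theorem statement16 (K : Set ℝ) (hK : IsCompact K) :
    ∃ C > (0:ℝ), ∀ k : ℕ, 1 ≤ k → ∀ x ∈ K,
      |hermiteFun k x| ≤ C * (k : ℝ) ^ (-(1:ℝ)/4) := by
  obtain ⟨M, hM⟩ := (hK.image (continuous_pow 2)).bddAbove
  choose B hB using fun k => hK.exists_bound_of_continuousOn (continuous_hermiteFun k).continuousOn
  obtain ⟨N, hN⟩ := exists_nat_ge M
  have hnn (k : ℕ) : 0 ≤ |B k| * (k : ℝ) ^ ((1 : ℝ) / 4) := by positivity
  have hsum := Finset.sum_nonneg fun k (_ : k ∈ Finset.range N) => hnn k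
  refine ⟨3 + ∑ k ∈ Finset.range N, |B k| * (k : ℝ) ^ ((1 : ℝ) / 4), by positivity,
    fun k hk x hx => ?_⟩
  have hk0 : (0 : ℝ) < k := by exact_mod_cast hk
  rcases lt_or_ge k N with hkN | hkN
  · have hle := Finset.single_le_sum (fun j _ => hnn j) (Finset.mem_range.2 hkN)
    calc |hermiteFun k x| ≤ |B k| := (hB k x hx).trans (le_abs_self _)
      _ = |B k| * (k : ℝ) ^ ((1 : ℝ) / 4) * (k : ℝ) ^ (-(1 : ℝ) / 4) := by
        rw [mul_assoc, ← Real.rpow_add hk0]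
        norm_num
      _ ≤ _ := by
        gcongr
        linarith
  · have hxM : x ^ 2 ≤ M := hM (mem_image_of_mem _ hx)
    have hNk : (N : ℝ) ≤ k := by exact_mod_cast hkN
    refine (abs_hermiteFun_le k hk x (by linarith)).trans ?_
    gcongr
    linarith

end
end

section
/- Let μ = 1_{[0,1/2]} + 1_{[1/4,3/4]} on (0,1) (so μ equals 1 on [0,1/4)∪(1/2,3/4], equals 2 on [1/4,1/2], and 0 on (3/4,1)). Then there exists a constant C > 0 such that for every k ∈ ℕ*, |∫₀¹ μ(x)·2·sin(πx)·sin(kπx) dx| ≥ C/k. In other words, the control potential μ satisfies the lower bound |⟨μφ₁,φ_k⟩| ≥ C/k for all k ∈ ℕ*, where φ_k(x) = √2·sin(kπx). -/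
open Set

noncomputable section

/-- The control potential `μ = 1_{[0,1/2]} + 1_{[1/4,3/4]}`. -/
def muD (x : ℝ) : ℝ :=
  indicator (Icc (0:ℝ) (1/2)) (fun _ => (1:ℝ)) x +
    indicator (Icc (1/4 : ℝ) (3/4)) (fun _ => (1:ℝ)) x

open MeasureTheory in
theorem integral_indicator_Icc_mul {a b : ℝ} (ha : 0 ≤ a) (hab : a ≤ b) (hb : b ≤ 1)
    (g : ℝ → ℝ) :
    ∫ x in (0:ℝ)..1, indicator (Icc a b) (fun _ => (1:ℝ)) x * g x = ∫ x in a..b, g x := by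
  have h : (fun x => indicator (Icc a b) (fun _ => (1:ℝ)) x * g x) = indicator (Icc a b) g := by
    funext x
    by_cases hx : x ∈ Icc a b <;> simp [hx]
  rw [h, intervalIntegral.integral_of_le zero_le_one, ← integral_Icc_eq_integral_Ioc,
    setIntegral_indicator measurableSet_Icc, inter_eq_right.2 (Icc_subset_Icc ha hb),
    integral_Icc_eq_integral_Ioc, ← intervalIntegral.integral_of_le hab]

theorem intervalIntegrable_indicator_Icc_mul (a b : ℝ) {g : ℝ → ℝ} (hg : Continuous g) :
    IntervalIntegrable (fun x => indicator (Icc a b) (fun _ => (1:ℝ)) x * g x)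
      MeasureTheory.volume 0 1 := by
  have h : (fun x => indicator (Icc a b) (fun _ => (1:ℝ)) x * g x) = indicator (Icc a b) g := by
    funext x
    by_cases hx : x ∈ Icc a b <;> simp [hx]
  have hi := hg.intervalIntegrable (μ := MeasureTheory.volume) 0 1
  rw [h]
  exact ⟨hi.1.indicator measurableSet_Icc, hi.2.indicator measurableSet_Icc⟩

theorem integral_muD_mul {g : ℝ → ℝ} (hg : Continuous g) :
    ∫ x in (0:ℝ)..1, muD x * g x =
      (∫ x in (0:ℝ)..(1/2), g x) + ∫ x in (1/4:ℝ)..(3/4), g x := by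
  simp only [muD, add_mul]
  rw [intervalIntegral.integral_add (intervalIntegrable_indicator_Icc_mul _ _ hg)
      (intervalIntegrable_indicator_Icc_mul _ _ hg),
    integral_indicator_Icc_mul le_rfl (by norm_num) (by norm_num),
    integral_indicator_Icc_mul (by norm_num) (by norm_num) (by norm_num)]

theorem integral_two_sin_mul_sin {k : ℝ} (hk : k ^ 2 - 1 ≠ 0) (a b : ℝ) :
    ∫ x in a..b, 2 * Real.sin (Real.pi * x) * Real.sin (k * Real.pi * x) =
      2 / (Real.pi * (k ^ 2 - 1)) *
        ((Real.sin (k * Real.pi * b) * Real.cos (Real.pi * b) -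
            k * Real.cos (k * Real.pi * b) * Real.sin (Real.pi * b)) -
          (Real.sin (k * Real.pi * a) * Real.cos (Real.pi * a) -
            k * Real.cos (k * Real.pi * a) * Real.sin (Real.pi * a))) := by
  rw [mul_sub]
  refine intervalIntegral.integral_eq_sub_of_hasDerivAt
    (f := fun x => 2 / (Real.pi * (k ^ 2 - 1)) *
      (Real.sin (k * Real.pi * x) * Real.cos (Real.pi * x) -
        k * Real.cos (k * Real.pi * x) * Real.sin (Real.pi * x))) (fun x _ => ?_)
    (Continuous.intervalIntegrable (by fun_prop) _ _)
  have h1 : HasDerivAt (fun x : ℝ => k * Real.pi * x) (k * Real.pi) x := by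
    simpa using (hasDerivAt_id x).const_mul (k * Real.pi)
  have h2 : HasDerivAt (fun x : ℝ => Real.pi * x) Real.pi x := by
    simpa using (hasDerivAt_id x).const_mul Real.pi
  refine (((h1.sin.mul h2.cos).sub
    ((h1.cos.const_mul k).mul h2.sin)).const_mul _).congr_deriv ?_
  have := Real.pi_ne_zero
  field_simp
  ring

theorem integral_two_sin_sq (a b : ℝ) :
    ∫ x in a..b, 2 * Real.sin (Real.pi * x) * Real.sin (Real.pi * x) =
      (b - Real.sin (Real.pi * b) * Real.cos (Real.pi * b) / Real.pi) -
        (a - Real.sin (Real.pi * a) * Real.cos (Real.pi * a) / Real.pi) := by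
  refine intervalIntegral.integral_eq_sub_of_hasDerivAt
    (f := fun x => x - Real.sin (Real.pi * x) * Real.cos (Real.pi * x) / Real.pi)
    (fun x _ => ?_) (Continuous.intervalIntegrable (by fun_prop) _ _)
  have h2 : HasDerivAt (fun x : ℝ => Real.pi * x) Real.pi x := by
    simpa using (hasDerivAt_id x).const_mul Real.pi
  refine ((hasDerivAt_id x).sub ((h2.sin.mul h2.cos).div_const _)).congr_deriv ?_
  have := Real.pi_ne_zero
  field_simp
  linear_combination -Real.sin_sq_add_cos_sq (Real.pi * x)

theorem sin_pi_mul_three_quarters : Real.sin (Real.pi * (3 / 4)) = √2 / 2 := by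
  rw [← Real.sin_pi_div_four, ← Real.sin_pi_sub]
  ring_nf

theorem cos_pi_mul_three_quarters : Real.cos (Real.pi * (3 / 4)) = -(√2 / 2) := by
  rw [← Real.cos_pi_div_four, ← Real.cos_pi_sub]
  ring_nf

theorem sin_pi_mul_quarter : Real.sin (Real.pi * (1 / 4)) = √2 / 2 := by
  rw [← Real.sin_pi_div_four]
  ring_nf

theorem cos_pi_mul_quarter : Real.cos (Real.pi * (1 / 4)) = √2 / 2 := by
  rw [← Real.cos_pi_div_four]
  ring_nf

/-- The numerator of `⟨μφ₁,φ_k⟩`, with `t = kπ/4`, is at least `k - 1` in absolute value. -/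
theorem sub_one_le_abs_numerator (k : ℕ) (hk : 1 ≤ k) {t : ℝ} (ht : t = k * Real.pi / 4) :
    (k:ℝ) - 1 ≤ |-k * Real.cos (2 * t) +
      √2 * Real.sin (2 * t) * (k * Real.sin t - Real.cos t)| := by
  have hk' : (1:ℝ) ≤ k := by exact_mod_cast hk
  rcases Nat.even_or_odd' k with ⟨j, hj | hj⟩
  · have h2 : 2 * t = j * Real.pi := by rw [ht, hj]; push_cast; ring
    rw [h2, Real.sin_nat_mul_pi]
    simp only [mul_zero, zero_mul, add_zero, abs_mul, abs_neg, Nat.abs_cast,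
      Real.cos_nat_mul_pi, abs_pow, abs_one, one_pow, mul_one]
    linarith
  · have h2 : 2 * t = Real.pi / 2 + j * Real.pi := by rw [ht, hj]; push_cast; ring
    have hc : Real.cos (2 * t) = 0 := by
      rw [h2, Real.cos_add_nat_mul_pi]; simp
    have hs := Real.sin_sq_add_cos_sq t
    have hc2 := Real.cos_two_mul t
    have hab : |2 * Real.sin t * Real.cos t| ≤ 1 := by
      rw [← Real.sin_two_mul]; exact Real.abs_sin_le_one _
    have hb : Real.cos t ^ 2 = 1 / 2 := by linarith
    have ha : Real.sin t ^ 2 = 1 / 2 := by linarith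
    have hN : -k * Real.cos (2 * t) + √2 * Real.sin (2 * t) * (k * Real.sin t - Real.cos t) =
        √2 * (k * Real.cos t - Real.sin t) := by
      rw [hc, Real.sin_two_mul]
      linear_combination 2 * √2 * k * Real.cos t * ha - 2 * √2 * Real.sin t * hb
    rw [hN]
    rw [← Real.sqrt_sq_eq_abs]
    apply Real.le_sqrt_of_sq_le
    have h3 : (√2 * (k * Real.cos t - Real.sin t)) ^ 2 =
        k ^ 2 + 1 - 2 * k * (2 * Real.sin t * Real.cos t) := by
      rw [mul_pow, Real.sq_sqrt zero_le_two]
      linear_combination 2 * k ^ 2 * hb + 2 * ha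
    rw [h3]
    nlinarith [(abs_le.1 hab).2]

/-- The potential `μ = 1_{[0,1/2]} + 1_{[1/4,3/4]}` satisfies the
spectral lower bound for the Dirichlet problem near the ground state: there is `C > 0`
with `|⟨μφ₁,φ_k⟩| = |∫₀¹ μ(x)·2 sin(πx) sin(kπx) dx| ≥ C/k` for every `k ∈ ℕ*`. -/
theorem statement17 :
    ∃ C > (0:ℝ), ∀ k : ℕ, 1 ≤ k →
      C / k ≤ |∫ x in (0:ℝ)..1,
        muD x * 2 * Real.sin (Real.pi * x) * Real.sin (k * Real.pi * x)| := by
  refine ⟨1 / Real.pi, by positivity, fun k hk => ?_⟩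
  have hpi := Real.pi_pos
  have h22 : √2 * √2 = 2 := Real.mul_self_sqrt zero_le_two
  have hk' : (1:ℝ) ≤ k := by exact_mod_cast hk
  have hg : ∫ x in (0:ℝ)..1, muD x * 2 * Real.sin (Real.pi * x) * Real.sin (k * Real.pi * x) =
      ∫ x in (0:ℝ)..1, muD x * (2 * Real.sin (Real.pi * x) * Real.sin (k * Real.pi * x)) := by
    simp only [mul_assoc]
  rw [hg, integral_muD_mul (by fun_prop)]
  have hs2 : Real.sin (Real.pi * (1 / 2)) = 1 := by rw [mul_one_div, Real.sin_pi_div_two]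
  have hc2 : Real.cos (Real.pi * (1 / 2)) = 0 := by rw [mul_one_div, Real.cos_pi_div_two]
  rcases hk.eq_or_lt with rfl | hk2
  · simp only [Nat.cast_one, one_mul, div_one]
    rw [integral_two_sin_sq, integral_two_sin_sq, hs2, hc2, sin_pi_mul_three_quarters,
      cos_pi_mul_three_quarters, sin_pi_mul_quarter, cos_pi_mul_quarter]
    refine le_trans ?_ (le_abs_self _)
    field_simp
    simp only [mul_zero, Real.sin_zero, Real.cos_zero]
    nlinarith
  · have hk2' : (2:ℝ) ≤ k := by exact_mod_cast hk2
    have hpos : (0:ℝ) < k ^ 2 - 1 := by nlinarith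
    rw [integral_two_sin_mul_sin hpos.ne', integral_two_sin_mul_sin hpos.ne', hs2, hc2,
      sin_pi_mul_three_quarters, cos_pi_mul_three_quarters, sin_pi_mul_quarter,
      cos_pi_mul_quarter, ← mul_add, abs_mul,
      abs_of_pos (div_pos two_pos (mul_pos hpi hpos))]
    obtain ⟨t, ht⟩ : ∃ t : ℝ, t = k * Real.pi / 4 := ⟨_, rfl⟩
    have e1 : k * Real.pi * (1 / 2) = 2 * t := by rw [ht]; ring
    have e2 : k * Real.pi * (3 / 4) = 2 * t + t := by rw [ht]; ring
    have e3 : k * Real.pi * (1 / 4) = 2 * t - t := by rw [ht]; ring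
    have hN := sub_one_le_abs_numerator k hk ht
    rw [e1, e2, e3, Real.sin_add, Real.cos_add, Real.sin_sub, Real.cos_sub]
    simp only [mul_zero, Real.sin_zero, Real.cos_zero]
    refine le_trans ?_ (mul_le_mul_of_nonneg_left (hN.trans_eq (congrArg _ ?_))
      (div_pos two_pos (mul_pos hpi hpos)).le)
    · rw [div_div, div_mul_eq_mul_div, div_le_div_iff₀ (by positivity) (mul_pos hpi hpos)]
      have : 0 ≤ Real.pi * ((k - 1) * (k - 1)) := by have := sub_nonneg.2 hk'; positivity
      nlinarith
    · ring

end
end
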